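/- Let R = k[x_0,…,x_n] be a polynomial ring over a field k, let 𝔪 = (x_0,…,x_n), and let I ⊆ R be a square-free monomial ideal with big-height e. Then for all positive integers m and t, I^{(t(m+e-1)-e+1)} ⊆ 𝔪^{(t-1)(e-1)} · (I^{(m)})^t. -/

import Mathlib

open MvPolynomial Pointwise

noncomputable section

/-- The contraction to `R` of the extension of `I ^ m` to the localization of `R` at the
prime ideal `P`, i.e. `R ∩ I^m R_P`. -/
def contractedPower {R : Type*} [CommRing R] (I : Ideal R) (m : ℕ)
    (P : Ideal R) (hP : P.IsPrime) : Ideal R :=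
  letI := hP
  (Ideal.map (algebraMap R (Localization.AtPrime P)) (I ^ m)).comap
    (algebraMap R (Localization.AtPrime P))

/-- `Q_{⊆ P} = R ∩ I R_P`, the contraction to `R` of the extension of `I` to `R_P`. -/
def Qsub {R : Type*} [CommRing R] (I P : Ideal R) (hP : P.IsPrime) : Ideal R :=
  letI := hP
  (Ideal.map (algebraMap R (Localization.AtPrime P)) I).comap
    (algebraMap R (Localization.AtPrime P))

/-- The `m`-th symbolic power `I^{(m)} = ⋂_{P ∈ Ass(I)} (R ∩ I^m R_P)`. -/
def symbolicPower {R : Type*} [CommRing R] (I : Ideal R) (m : ℕ) : Ideal R :=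
  ⨅ P : {P : Ideal R // P ∈ associatedPrimes R (R ⧸ I)},
    contractedPower I m P.1 P.2.isPrime

/-- The set of associated primes of `I` that are maximal with respect to inclusion. -/
def maxAss {R : Type*} [CommRing R] (I : Ideal R) : Set (Ideal R) :=
  {P | P ∈ associatedPrimes R (R ⧸ I) ∧
    ∀ P' ∈ associatedPrimes R (R ⧸ I), P ≤ P' → P = P'}

/-- A monomial ideal: an ideal generated by monomials. -/
def IsMonomialIdeal {k : Type*} [Field k] {n : ℕ}
    (I : Ideal (MvPolynomial (Fin (n + 1)) k)) : Prop :=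
  ∃ S : Set (Fin (n + 1) →₀ ℕ),
    I = Ideal.span ((fun a => (monomial a (1 : k) : MvPolynomial (Fin (n + 1)) k)) '' S)

/-- A square-free monomial ideal: an ideal generated by square-free monomials. -/
def IsSquarefreeMonomialIdeal {k : Type*} [Field k] {n : ℕ}
    (I : Ideal (MvPolynomial (Fin (n + 1)) k)) : Prop :=
  ∃ S : Set (Fin (n + 1) →₀ ℕ), (∀ a ∈ S, ∀ i, a i ≤ 1) ∧
    I = Ideal.span ((fun a => (monomial a (1 : k) : MvPolynomial (Fin (n + 1)) k)) '' S)

/-- The height of a prime ideal. -/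
def primeHeight {R : Type*} [CommRing R] (P : Ideal R) (hP : P.IsPrime) : ℕ∞ :=
  Order.height (⟨P, hP⟩ : PrimeSpectrum R)

/-- `e` is the big-height of `I`: the maximum of the heights of the associated primes of `I`. -/
def IsBigHeight {R : Type*} [CommRing R] (I : Ideal R) (e : ℕ) : Prop :=
  (∀ P, ∀ h : P ∈ associatedPrimes R (R ⧸ I), primeHeight P h.isPrime ≤ (e : ℕ∞)) ∧
    ∃ P, ∃ h : P ∈ associatedPrimes R (R ⧸ I), primeHeight P h.isPrime = (e : ℕ∞)

/-- The irrelevant maximal ideal `𝔪 = (x_0, …, x_n)`. -/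
def mId (k : Type*) [Field k] (n : ℕ) : Ideal (MvPolynomial (Fin (n + 1)) k) :=
  Ideal.span (Set.range X)

/-- The exponent vector of a monomial, viewed as a point of `ℝ^{n+1}`. -/
def expVec {n : ℕ} (a : Fin (n + 1) →₀ ℕ) : Fin (n + 1) → ℝ := fun i => (a i : ℝ)

/-- `L(J)`: the set of exponent vectors of the monomials lying in `J`. -/
def latticePoints {k : Type*} [Field k] {n : ℕ}
    (J : Ideal (MvPolynomial (Fin (n + 1)) k)) : Set (Fin (n + 1) → ℝ) :=
  {v | ∃ a : Fin (n + 1) →₀ ℕ, monomial a (1 : k) ∈ J ∧ v = expVec a}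

/-- The exponent vectors of the minimal monomial generators of a monomial ideal. -/
def minGens {k : Type*} [Field k] {n : ℕ}
    (J : Ideal (MvPolynomial (Fin (n + 1)) k)) : Set (Fin (n + 1) →₀ ℕ) :=
  {a | monomial a (1 : k) ∈ J ∧
    ∀ b : Fin (n + 1) →₀ ℕ, monomial b (1 : k) ∈ J → b ≤ a → b = a}

/-- The symbolic polyhedron `𝒬 = ⋂_{P ∈ maxAss(I)} conv(L(Q_{⊆P}))`. -/
def symbolicPolyhedron {k : Type*} [Field k] {n : ℕ}
    (I : Ideal (MvPolynomial (Fin (n + 1)) k)) : Set (Fin (n + 1) → ℝ) :=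
  ⋂ P : {P : Ideal (MvPolynomial (Fin (n + 1)) k) // P ∈ maxAss I},
    convexHull ℝ (latticePoints (Qsub I P.1 P.2.1.isPrime))

/-- `α(J)`: the least degree of a nonzero (homogeneous) element of `J`. -/
def alphaI {k : Type*} [Field k] {n : ℕ}
    (J : Ideal (MvPolynomial (Fin (n + 1)) k)) : ℕ :=
  sInf {d | ∃ f ∈ J, f ≠ 0 ∧ MvPolynomial.IsHomogeneous f d}

/-- `β(J)`: the largest degree of a minimal generator of the monomial ideal `J`. -/
def betaI {k : Type*} [Field k] {n : ℕ}
    (J : Ideal (MvPolynomial (Fin (n + 1)) k)) : ℕ :=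
  sSup {d | ∃ a ∈ minGens J, ∑ i, a i = d}

/-- `α(𝒫) = inf { a_0 + ⋯ + a_n : a ∈ 𝒫 }` for a subset `𝒫 ⊆ ℝ^{n+1}`. -/
def alphaSet {n : ℕ} (P : Set (Fin (n + 1) → ℝ)) : ℝ :=
  sInf ((fun v => ∑ i, v i) '' P)

/-- The set of all conical (nonnegative) combinations of elements of `S`. -/
def conicalHull {E : Type*} [AddCommMonoid E] [Module ℝ E] (S : Set E) : Set E :=
  {x | ∃ (t : Finset E) (c : E → ℝ), ↑t ⊆ S ∧ (∀ y, 0 ≤ c y) ∧ x = ∑ y ∈ t, c y • y}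

/-- The staircase of a monomial ideal `J`. -/
def stairs {k : Type*} [Field k] {n : ℕ}
    (J : Ideal (MvPolynomial (Fin (n + 1)) k)) : Set (Fin (n + 1) → ℝ) :=
  {v | (∀ i, 0 ≤ v i) ∧
    ∃ a : Fin (n + 1) →₀ ℕ, monomial a (1 : k) ∈ J ∧ ∀ i, (a i : ℝ) ≤ v i}

end

/-- The substitution `X i ↦ T * X i` for `i ∈ A` and `X i ↦ X i` otherwise, with values in
polynomials in `T`. -/
noncomputable def scaleVars {σ : Type*} (k : Type*) [CommRing k] [DecidableEq σ] (A : Finset σ) :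
    MvPolynomial σ k →ₐ[k] Polynomial (MvPolynomial σ k) :=
  aeval fun i => Polynomial.C (X i) * Polynomial.X ^ (if i ∈ A then 1 else 0)

section ScaleVars

variable {σ k : Type*} [Fintype σ] [DecidableEq σ]

lemma scaleVars_monomial [CommRing k] (A : Finset σ) (a : σ →₀ ℕ) (c : k) :
    scaleVars k A (monomial a c) = Polynomial.monomial (∑ i ∈ A, a i) (monomial a c) := by
  rw [scaleVars, aeval_monomial, Finsupp.prod_fintype _ _ (by simp)]
  simp_rw [mul_pow, Finset.prod_mul_distrib, ← pow_mul, Finset.prod_pow_eq_pow_sum,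
    ← Polynomial.C_pow, ← map_prod, ite_mul, one_mul, zero_mul]
  rw [← Polynomial.C_mul_X_pow_eq_monomial, monomial_eq, Finsupp.prod_fintype _ _ (by simp),
    Finset.sum_ite_mem, Finset.univ_inter, ← mul_assoc, Polynomial.C_mul]
  rfl

lemma coeff_coeff_scaleVars [CommRing k] (A : Finset σ) (f : MvPolynomial σ k) (d : ℕ)
    (a : σ →₀ ℕ) :
    ((scaleVars k A f).coeff d).coeff a = if ∑ i ∈ A, a i = d then f.coeff a else 0 := by
  induction f using MvPolynomial.induction_on' with
  | monomial b c =>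
    rw [scaleVars_monomial, Polynomial.coeff_monomial]
    by_cases hba : b = a
    · subst hba
      split_ifs <;> simp
    · split_ifs <;> simp [coeff_monomial, hba]
  | add p q hp hq =>
    rw [map_add, Polynomial.coeff_add, coeff_add, hp, hq]
    split_ifs <;> simp

lemma X_pow_dvd_scaleVars_iff [CommRing k] (A : Finset σ) (f : MvPolynomial σ k) (m : ℕ) :
    Polynomial.X ^ m ∣ scaleVars k A f ↔ ∀ a ∈ f.support, m ≤ ∑ i ∈ A, a i := by
  rw [Polynomial.X_pow_dvd_iff]
  constructor
  · intro h a ha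
    by_contra! hlt
    have := congrArg (coeff a) (h _ hlt)
    rw [coeff_coeff_scaleVars, if_pos rfl] at this
    exact mem_support_iff.mp ha (by simpa using this)
  · intro h d hd
    ext a
    rw [coeff_coeff_scaleVars, coeff_zero]
    split_ifs with had
    · by_contra hne
      have := h a (mem_support_iff.mpr hne)
      omega
    · rfl

lemma mem_span_X_image_iff_X_dvd_scaleVars [CommRing k] (A : Finset σ) (f : MvPolynomial σ k) :
    f ∈ Ideal.span (X '' (A : Set σ)) ↔ Polynomial.X ∣ scaleVars k A f := by
  rw [← pow_one Polynomial.X, X_pow_dvd_scaleVars_iff, mem_ideal_span_X_image]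
  refine forall₂_congr fun a _ => ?_
  simp [Nat.one_le_iff_ne_zero, Finset.sum_eq_zero_iff]

lemma isPrime_span_X_image [Field k] (A : Finset σ) :
    (Ideal.span (X '' (A : Set σ)) : Ideal (MvPolynomial σ k)).IsPrime := by
  have hX : (Ideal.span {(Polynomial.X : Polynomial (MvPolynomial σ k))}).IsPrime :=
    (Ideal.span_singleton_prime Polynomial.X_ne_zero).mpr Polynomial.prime_X
  convert hX.comap (scaleVars k A)
  ext f
  rw [mem_span_X_image_iff_X_dvd_scaleVars, Ideal.mem_comap, Ideal.mem_span_singleton]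

lemma card_le_primeHeight_span_X_image [Field k] (A : Finset σ)
    (h : (Ideal.span (X '' (A : Set σ)) : Ideal (MvPolynomial σ k)).IsPrime) :
    (A.card : ℕ∞) ≤ primeHeight _ h := by
  induction A using Finset.induction_on with
  | empty => simp
  | insert i A hi ih =>
    have hA := isPrime_span_X_image (k := k) A
    rw [Finset.card_insert_of_notMem hi, Nat.cast_add, Nat.cast_one]
    refine (add_le_add_left (ih hA) 1).trans (Order.height_add_one_le ?_)
    rw [← PrimeSpectrum.asIdeal_lt_asIdeal]
    refine lt_of_le_of_ne (Ideal.span_mono (Set.image_mono (by simp))) fun heq => hi ?_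
    have hX : (X i : MvPolynomial σ k) ∈ Ideal.span (X '' (A : Set σ)) := by
      change Ideal.span _ = Ideal.span _ at heq
      rw [heq]
      exact Ideal.subset_span (by simp)
    rw [mem_ideal_span_X_image] at hX
    obtain ⟨j, hj, hj'⟩ := hX (Finsupp.single i 1) (by simp [support_X])
    rw [Finsupp.single_apply_ne_zero] at hj'
    simpa [hj'.1] using hj

/-- Membership in `R ∩ I^m R_P` when `P` is generated by variables and `I R_P = P R_P`. -/
lemma mem_contractedPower_span_X_image_iff [Field k] {I : Ideal (MvPolynomial σ k)} {A : Finset σ}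
    (hP : (Ideal.span (X '' (A : Set σ)) : Ideal (MvPolynomial σ k)).IsPrime)
    (hI : I ≤ Ideal.span (X '' (A : Set σ)))
    {g : MvPolynomial σ k} (hg : g ∉ Ideal.span (X '' (A : Set σ)))
    (hgI : ∀ i ∈ A, g * X i ∈ I) (m : ℕ) (f : MvPolynomial σ k) :
    f ∈ contractedPower I m _ hP ↔ ∀ a ∈ f.support, m ≤ ∑ i ∈ A, a i := by
  have hmem (f : MvPolynomial σ k) : f ∈ contractedPower I m _ hP ↔
      ∃ s ∈ (Ideal.span (X '' (A : Set σ)) : Ideal (MvPolynomial σ k)).primeCompl,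
        s * f ∈ I ^ m := by
    rw [contractedPower, Ideal.mem_comap, IsLocalization.algebraMap_mem_map_algebraMap_iff
      (Ideal.span (X '' (A : Set σ)) : Ideal (MvPolynomial σ k)).primeCompl]
  constructor
  · rw [hmem]
    rintro ⟨s, hs, hsf⟩
    rw [← X_pow_dvd_scaleVars_iff]
    refine Polynomial.prime_X.pow_dvd_of_dvd_mul_left m (a := scaleVars k A s) ?_ ?_
    · rwa [← mem_span_X_image_iff_X_dvd_scaleVars]
    · rw [← map_mul, ← Ideal.mem_span_singleton, ← Ideal.span_singleton_pow, ← Ideal.mem_comap]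
      refine Ideal.le_comap_pow _ m (Ideal.pow_right_mono (fun p hp => ?_) m hsf)
      rw [Ideal.mem_comap, Ideal.mem_span_singleton, ← mem_span_X_image_iff_X_dvd_scaleVars]
      exact hI hp
  · intro h
    rw [f.as_sum]
    refine Ideal.sum_mem _ fun a ha => (hmem _).mpr ⟨g ^ ∑ i ∈ A, a i, ?_, ?_⟩
    · exact Submonoid.pow_mem _ hg _
    · refine Ideal.pow_le_pow_right (h a ha) ?_
      rw [monomial_eq, Finsupp.prod_fintype _ _ (by simp), ← Finset.prod_mul_prod_compl A,
        mul_left_comm, ← mul_assoc (g ^ _), ← Finset.prod_pow_eq_pow_sum A _ g,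
        ← Finset.prod_mul_distrib, ← Finset.prod_pow_eq_pow_sum A _ I]
      refine Ideal.mul_mem_left _ _ (Ideal.mul_mem_right _ _ (Ideal.prod_mem_prod fun i hi => ?_))
      rw [← mul_pow]
      exact Ideal.pow_mem_pow (hgI i hi) _

end ScaleVars

section SquarefreeMonomial

variable {k : Type*} [Field k] {n : ℕ} {I : Ideal (MvPolynomial (Fin (n + 1)) k)}

/-- A square-free monomial ideal is an intersection of ideals generated by variables. -/
lemma IsSquarefreeMonomialIdeal.exists_eq_inf (hI : IsSquarefreeMonomialIdeal I) :
    ∃ T : Finset (Finset (Fin (n + 1))),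
      I = T.inf fun A => Ideal.span (X '' (A : Set (Fin (n + 1)))) := by
  classical
  obtain ⟨S, hS, rfl⟩ := hI
  refine ⟨Finset.univ.filter fun A => ∀ b ∈ S, ∃ i ∈ A, b i ≠ 0, le_antisymm ?_ ?_⟩
  · refine Finset.le_inf fun A hA => Ideal.span_le.mpr ?_
    rintro _ ⟨b, hb, rfl⟩
    rw [SetLike.mem_coe, mem_ideal_span_X_image]
    intro c hc
    rw [Finset.mem_singleton.mp (support_monomial_subset hc)]
    exact (Finset.mem_filter.mp hA).2 b hb
  · intro f hf
    rw [mem_ideal_span_monomial_image]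
    intro c hc
    by_contra! hcon
    have hA : c.supportᶜ ∈ Finset.univ.filter
        fun A : Finset (Fin (n + 1)) => ∀ b ∈ S, ∃ i ∈ A, b i ≠ 0 := by
      refine Finset.mem_filter.mpr ⟨Finset.mem_univ _, fun b hb => ?_⟩
      obtain ⟨i, hi⟩ := not_forall.mp (hcon b hb)
      have := hS b hb i
      exact ⟨i, by simp; omega, by omega⟩
    obtain ⟨i, hi, hi'⟩ := mem_ideal_span_X_image.mp (Submodule.mem_finsetInf.mp hf _ hA) c hc
    simp_all

/-- An associated prime `P` of a square-free monomial ideal `I` is generated by variables, and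
`I` and `P` agree after localizing at `P`. -/
lemma IsSquarefreeMonomialIdeal.exists_eq_span_X_image (hI : IsSquarefreeMonomialIdeal I)
    {P : Ideal (MvPolynomial (Fin (n + 1)) k)} (hP : P ∈ associatedPrimes _ (_ ⧸ I)) :
    ∃ A : Finset (Fin (n + 1)), P = Ideal.span (X '' (A : Set (Fin (n + 1)))) ∧ I ≤ P ∧
      ∃ g ∉ P, ∀ p ∈ P, g * p ∈ I := by
  obtain ⟨hprime, x, hx⟩ := isAssociatedPrime_iff.mp hP
  obtain ⟨g, rfl⟩ := Ideal.Quotient.mk_surjective x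
  have hmem (p) : p ∈ P ↔ g * p ∈ I := by
    rw [hx, Submodule.mem_colon_singleton, Submodule.mem_bot, mul_comm,
      ← Ideal.Quotient.eq_zero_iff_mem, map_mul]
    rfl
  have hIP : I ≤ P := fun p hp => (hmem p).mpr (I.mul_mem_left g hp)
  obtain ⟨T, hT⟩ := hI.exists_eq_inf
  have hgI : g ∉ I := fun h => hprime.ne_top (P.eq_top_iff_one.mpr ((hmem 1).mpr (by simpa)))
  classical
  have hinf : (T.filter fun A : Finset (Fin (n + 1)) => g ∉ Ideal.span (X '' (A : Set _))).inf
      (fun A => (Ideal.span (X '' (A : Set (Fin (n + 1)))) : Ideal (MvPolynomial _ k))) ≤ P := by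
    intro p hp
    rw [hmem, hT, Submodule.mem_finsetInf]
    intro A hA
    by_cases hgA : g ∈ Ideal.span (X '' (A : Set (Fin (n + 1))))
    · exact Ideal.mul_mem_right _ _ hgA
    · exact Ideal.mul_mem_left _ _
        (Submodule.mem_finsetInf.mp hp A (Finset.mem_filter.mpr ⟨hA, hgA⟩))
  obtain ⟨A, hA, hAP⟩ := hprime.inf_le'.mp hinf
  obtain ⟨hAT, hgA⟩ := Finset.mem_filter.mp hA
  have hPA : P = Ideal.span (X '' (A : Set (Fin (n + 1)))) := by
    refine le_antisymm (fun p hp => ?_) hAP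
    have hgp := (hmem p).mp hp
    rw [hT, Submodule.mem_finsetInf] at hgp
    exact ((isPrime_span_X_image A).mem_or_mem (hgp A hAT)).resolve_left hgA
  exact ⟨A, hPA, hIP, g, hPA ▸ hgA, fun p hp => (hmem p).mp hp⟩

lemma IsSquarefreeMonomialIdeal.mem_symbolicPower_iff (hI : IsSquarefreeMonomialIdeal I) (m : ℕ)
    (f : MvPolynomial (Fin (n + 1)) k) :
    f ∈ symbolicPower I m ↔ ∀ A : Finset (Fin (n + 1)),
      Ideal.span (X '' (A : Set (Fin (n + 1)))) ∈ associatedPrimes (MvPolynomial _ k) (_ ⧸ I) →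
        ∀ a ∈ f.support, m ≤ ∑ i ∈ A, a i := by
  have key (A : Finset (Fin (n + 1)))
      (hA : Ideal.span (X '' (A : Set _)) ∈ associatedPrimes (MvPolynomial _ k) (_ ⧸ I)) :
      f ∈ contractedPower I m _ hA.isPrime ↔ ∀ a ∈ f.support, m ≤ ∑ i ∈ A, a i := by
    obtain ⟨-, -, hIP, g, hg, hgI⟩ := hI.exists_eq_span_X_image hA
    exact mem_contractedPower_span_X_image_iff _ hIP hg
      (fun i hi => hgI _ (Ideal.subset_span ⟨i, hi, rfl⟩)) m f
  rw [symbolicPower, Submodule.mem_iInf]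
  constructor
  · exact fun h A hA => (key A hA).mp (h ⟨_, hA⟩)
  · rintro h ⟨P, hP⟩
    obtain ⟨A, rfl, -⟩ := hI.exists_eq_span_X_image hP
    exact (key A hP).mpr (h A hP)

end SquarefreeMonomial

/-- If every set of the family `𝒜` has at most `e` elements, then an exponent vector of large
weight on all members of `𝒜` dominates `t` times a vector of weight at least `m` on all members
of `𝒜`, with a remainder of degree at least `(t - 1) * (e - 1)`. -/
lemma exists_smul_add_eq_of_le_sum {σ : Type*} [Fintype σ] {𝒜 : Set (Finset σ)}
    (h𝒜 : 𝒜.Nonempty) {e m t : ℕ} (hcard : ∀ A ∈ 𝒜, A.card ≤ e) (hm : 1 ≤ m) (ht : 1 ≤ t)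
    {a : σ →₀ ℕ} (ha : ∀ A ∈ 𝒜, t * (m + e - 1) - e + 1 ≤ ∑ i ∈ A, a i) :
    ∃ b c : σ →₀ ℕ, t • b + c = a ∧ (∀ A ∈ 𝒜, m ≤ ∑ i ∈ A, b i) ∧
      (t - 1) * (e - 1) ≤ c.degree := by
  classical
  obtain ⟨t, rfl⟩ := Nat.exists_eq_add_of_le' ht
  obtain ⟨m, rfl⟩ := Nat.exists_eq_add_of_le' hm
  obtain ⟨A₀, hA₀⟩ := h𝒜
  obtain _ | e := e
  · have h0 := ha A₀ hA₀
    rw [Finset.card_eq_zero.mp (Nat.le_zero.mp (hcard A₀ hA₀)), Finset.sum_empty] at h0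
    omega
  have hexp : (t + 1) * (m + 1 + (e + 1) - 1) - (e + 1) + 1 = t * m + t + t * e + m + 1 := by
    have : (t + 1) * (m + 1 + (e + 1) - 1) = t * m + t + t * e + m + 1 + e := by
      rw [show m + 1 + (e + 1) - 1 = m + 1 + e by omega]
      ring
    omega
  rw [hexp] at ha
  let q : σ →₀ ℕ := a.mapRange (· / (t + 1)) (by simp)
  have hq (A) (hA : A ∈ 𝒜) : m + 1 ≤ ∑ i ∈ A, q i := by
    have hle : ∑ i ∈ A, a i ≤ (t + 1) * ∑ i ∈ A, q i + A.card * t := by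
      rw [Finset.mul_sum, ← smul_eq_mul A.card, ← Finset.sum_const, ← Finset.sum_add_distrib]
      refine Finset.sum_le_sum fun i _ => ?_
      have h1 := Nat.div_add_mod (a i) (t + 1)
      have h2 := Nat.mod_lt (a i) t.succ_pos
      simp only [q, Finsupp.mapRange_apply]
      lia
    have hc := Nat.mul_le_mul_right t (hcard A hA)
    have := ha A hA
    by_contra! hlt
    have := Nat.mul_le_mul_left (t + 1) (Nat.le_of_lt_succ hlt)
    nlinarith
  obtain ⟨b, hbq, hb⟩ := exists_minimal_le_of_wellFoundedLT
    (fun b : σ →₀ ℕ => ∀ A ∈ 𝒜, m + 1 ≤ ∑ i ∈ A, b i) q hq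
  have hba : (t + 1) • b ≤ a := fun i => by
    have := Nat.mul_le_mul_left (t + 1) (hbq i)
    exact this.trans (Nat.mul_div_le _ _)
  refine ⟨b, a - (t + 1) • b, add_tsub_cancel_of_le hba, hb.prop, ?_⟩
  obtain ⟨A, hA, hAb⟩ : ∃ A ∈ 𝒜, ∑ i ∈ A, b i = m + 1 := by
    obtain ⟨i, -, hi⟩ : ∃ i ∈ A₀, b i ≠ 0 := by
      by_contra! h0
      have := hb.prop A₀ hA₀
      rw [Finset.sum_eq_zero h0] at this
      omega
    by_contra! hne
    have hlt (A) (hA : A ∈ 𝒜) : m + 1 ≤ ∑ j ∈ A, (b - Finsupp.single i 1 : σ →₀ ℕ) j := by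
      have h1 := (hne A hA).symm.lt_of_le (hb.prop A hA)
      have h2 : ∑ j ∈ A, b j ≤ ∑ j ∈ A, (b - Finsupp.single i 1 : σ →₀ ℕ) j +
          ∑ j ∈ A, (Finsupp.single i 1 : σ →₀ ℕ) j := by
        rw [← Finset.sum_add_distrib]
        exact Finset.sum_le_sum fun j _ => by rw [Finsupp.tsub_apply]; omega
      have h3 : ∑ j ∈ A, (Finsupp.single i 1 : σ →₀ ℕ) j ≤ 1 := by
        simp only [Finsupp.single_apply, Finset.sum_ite_eq]
        split_ifs <;> simp
      omega
    have := hb.le_of_le hlt tsub_le_self i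
    simp only [Finsupp.tsub_apply, Finsupp.single_eq_same] at this
    omega
  have hsum : ∑ i ∈ A, (a - (t + 1) • b) i + (t + 1) * (m + 1) = ∑ i ∈ A, a i := by
    rw [← hAb, Finset.mul_sum, ← Finset.sum_add_distrib]
    exact Finset.sum_congr rfl fun i _ => Nat.sub_add_cancel (hba i)
  have hdeg : ∑ i ∈ A, (a - (t + 1) • b) i ≤ (a - (t + 1) • b).degree := by
    rw [Finsupp.degree_eq_sum]
    exact Finset.sum_le_sum_of_subset (Finset.subset_univ A)
  have := ha A hA
  simp only [Nat.add_sub_cancel]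
  nlinarith

theorem squarefree_symbolic_containment_r_eq_one {k : Type*} [Field k] {n : ℕ}
    (I : Ideal (MvPolynomial (Fin (n + 1)) k)) (hsf : IsSquarefreeMonomialIdeal I)
    (e : ℕ) (he : IsBigHeight I e) (m t : ℕ) (hm : 1 ≤ m) (ht : 1 ≤ t) :
    symbolicPower I (t * (m + e - 1) - e + 1) ≤
      mId k n ^ ((t - 1) * (e - 1)) * symbolicPower I m ^ t := by
  intro f hf
  rw [hsf.mem_symbolicPower_iff] at hf
  obtain ⟨hle, P, hP, -⟩ := he
  obtain ⟨A₀, rfl, -⟩ := hsf.exists_eq_span_X_image hP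
  let 𝒜 : Set (Finset (Fin (n + 1))) := {A | (Ideal.span (X '' (A : Set (Fin (n + 1)))) :
    Ideal (MvPolynomial (Fin (n + 1)) k)) ∈ associatedPrimes _ (MvPolynomial (Fin (n + 1)) k ⧸ I)}
  have hcard (A) (hA : A ∈ 𝒜) : A.card ≤ e :=
    Nat.cast_le.mp ((card_le_primeHeight_span_X_image A hA.isPrime).trans (hle _ hA))
  rw [f.as_sum]
  refine Ideal.sum_mem _ fun a ha => ?_
  obtain ⟨b, c, habc, hb, hc⟩ := exists_smul_add_eq_of_le_sum
    ⟨A₀, hP⟩ hcard hm ht (fun A hA => hf A hA a ha)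
  have hmul : monomial a (f.coeff a) = monomial c (f.coeff a) * monomial b 1 ^ t := by
    rw [monomial_pow, monomial_mul, one_pow, mul_one, add_comm c, habc]
  rw [hmul]
  refine Ideal.mul_mem_mul ?_ (Ideal.pow_mem_pow ?_ t)
  · refine (mem_pow_idealOfVars_iff _ _).mpr fun d hd => ?_
    rwa [Finset.mem_singleton.mp (support_monomial_subset hd)]
  · rw [hsf.mem_symbolicPower_iff]
    intro A hA d hd
    rw [Finset.mem_singleton.mp (support_monomial_subset hd)]
    exact hb A hA
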